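/- The pair (L_1, L_2) of empirical spin and bond measures of the spinned d-regular configuration model with spin law μ satisfies a large deviation principle on L([q]) × L̃_*([q]×[q]) with speed n and good rate function I(ρ,ν) = H(ρ||μ) + (d/2) H(ν||ρ⊗ρ) for admissible (ρ,ν), and I = ∞ otherwise. -/

import Mathlib

open Filter
open scoped Classical

/-- Extended-real logarithm on `ℝ≥0∞`, with `log 0 = ⊥` and `log ⊤ = ⊤`. -/
noncomputable def elog (x : ENNReal) : EReal :=
  if x = 0 then ⊥ else if x = ⊤ then ⊤ else ((Real.log x.toReal : ℝ) : EReal)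

/-- `(ρ, ν)` is admissible: `ρ` a probability vector, `ν` a symmetric probability vector
on `[q]²` with first marginal `ρ`. -/
def IsAdmissible {q : ℕ} (p : (Fin q → ℝ) × (Fin q × Fin q → ℝ)) : Prop :=
  (∀ i, 0 ≤ p.1 i) ∧ (∑ i, p.1 i) = 1 ∧ (∀ a, 0 ≤ p.2 a) ∧
    (∀ i j, p.2 (i, j) = p.2 (j, i)) ∧ (∀ i, ∑ j, p.2 (i, j) = p.1 i)

/-- The rate function `I(ρ,ν) = H(ρ‖μ) + (d/2) H(ν‖ρ⊗ρ)` on admissible pairs, `∞`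
elsewhere. -/
noncomputable def rate {q : ℕ} (μ : Fin q → ℝ) (d : ℕ)
    (p : (Fin q → ℝ) × (Fin q × Fin q → ℝ)) : ENNReal :=
  if IsAdmissible p then
    ENNReal.ofReal ((∑ i, p.1 i * Real.log (p.1 i / μ i)) +
      (d : ℝ) / 2 * ∑ i, ∑ j, p.2 (i, j) * Real.log (p.2 (i, j) / (p.1 i * p.1 j)))
  else ⊤

/-- The set of pairings (fixed-point-free involutions) of the `N` half-edges. -/
noncomputable def pairings (N : ℕ) : Finset (Equiv.Perm (Fin N)) :=
  Finset.univ.filter (fun f => (∀ p, f (f p) = p) ∧ ∀ p, f p ≠ p)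

/-- Empirical spin measure `L₁` of a spin configuration. -/
noncomputable def empSpin (q n : ℕ) (η : Fin n → Fin q) : Fin q → ℝ :=
  fun y => ((Finset.univ.filter fun i => η i = y).card : ℝ) / n

/-- Empirical bond measure `L₂` of a spin configuration and a pairing of the half-edges. -/
noncomputable def empBond (q n d : ℕ) (η : Fin n → Fin q)
    (f : Equiv.Perm (Fin (n * d))) : Fin q × Fin q → ℝ :=
  fun a => ((Finset.univ.filter fun p : Fin (n * d) =>
      η ⟨p.val / d, Nat.div_lt_of_lt_mul (Nat.mul_comm n d ▸ p.isLt)⟩ = a.1 ∧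
      η ⟨(f p).val / d, Nat.div_lt_of_lt_mul (Nat.mul_comm n d ▸ (f p).isLt)⟩ = a.2).card : ℝ)
    / (n * d)

/-- The probability in the spinned configuration model that `(L₁, L₂) ∈ F`. -/
noncomputable def configProb (q n d : ℕ) (μ : Fin q → ℝ)
    (F : Set ((Fin q → ℝ) × (Fin q × Fin q → ℝ))) : ℝ :=
  (∑ f ∈ pairings (n * d), ∑ η : Fin n → Fin q,
      (∏ i, μ (η i)) * (if (empSpin q n η, empBond q n d η f) ∈ F then 1 else 0)) /
    (pairings (n * d)).card

/-! ### Rate function -/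

/-- Continuous representative of the rate function on admissible pairs. -/
noncomputable def rateG {q : ℕ} (μ : Fin q → ℝ) (d : ℕ)
    (p : (Fin q → ℝ) × (Fin q × Fin q → ℝ)) : ℝ :=
  -(∑ i, p.1 i * Real.log (μ i)) + (1 - (d : ℝ)) * (∑ i, p.1 i * Real.log (p.1 i)) +
    (d : ℝ) / 2 * ∑ a, p.2 a * Real.log (p.2 a)

lemma rateG_continuous {q : ℕ} (μ : Fin q → ℝ) (d : ℕ) : Continuous (rateG μ d) := by
  unfold rateG
  refine Continuous.add (Continuous.add ?_ ?_) ?_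
  · fun_prop
  · refine continuous_const.mul (continuous_finsetSum _ fun i _ => ?_)
    exact Real.continuous_mul_log.comp (by fun_prop : Continuous
      fun p : (Fin q → ℝ) × (Fin q × Fin q → ℝ) => p.1 i)
  · refine continuous_const.mul (continuous_finsetSum _ fun i _ => ?_)
    exact Real.continuous_mul_log.comp (by fun_prop : Continuous
      fun p : (Fin q → ℝ) × (Fin q × Fin q → ℝ) => p.2 i)

lemma adm_le {q : ℕ} {p : (Fin q → ℝ) × (Fin q × Fin q → ℝ)} (h : IsAdmissible p)
    (i j : Fin q) : p.2 (i, j) ≤ p.1 i := by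
  obtain ⟨_, _, h3, _, h5⟩ := h
  rw [← h5 i]
  exact Finset.single_le_sum (f := fun j => p.2 (i, j)) (fun j _ => h3 (i, j)) (Finset.mem_univ j)

lemma rate_eq {q : ℕ} (μ : Fin q → ℝ) (hμ0 : ∀ i, 0 < μ i) (d : ℕ)
    {p : (Fin q → ℝ) × (Fin q × Fin q → ℝ)} (h : IsAdmissible p) :
    rate μ d p = ENNReal.ofReal (rateG μ d p) := by
  have hle := adm_le h
  unfold rate rateG
  rw [if_pos h]
  congr 1
  obtain ⟨h1, h2, h3, h4, h5⟩ := h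
  have e1 : ∀ i, p.1 i * Real.log (p.1 i / μ i) =
      p.1 i * Real.log (p.1 i) - p.1 i * Real.log (μ i) := by
    intro i
    rcases (h1 i).eq_or_lt with h0 | h0
    · simp [← h0]
    · rw [Real.log_div h0.ne' (hμ0 i).ne']; ring
  have e2 : ∀ i j, p.2 (i, j) * Real.log (p.2 (i, j) / (p.1 i * p.1 j)) =
      p.2 (i, j) * Real.log (p.2 (i, j)) - p.2 (i, j) * Real.log (p.1 i)
        - p.2 (j, i) * Real.log (p.1 j) := by
    intro i j
    rcases (h3 (i, j)).eq_or_lt with h0 | h0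
    · have : p.2 (j, i) = 0 := by rw [h4, ← h0]
      simp [← h0, this]
    · have hi : 0 < p.1 i := h0.trans_le (hle i j)
      have hj : 0 < p.1 j := (h4 i j ▸ h0).trans_le (hle j i)
      rw [Real.log_div h0.ne' (mul_pos hi hj).ne', Real.log_mul hi.ne' hj.ne', h4 j i]; ring
  simp only [e1, e2, Finset.sum_sub_distrib]
  have e3 : ∑ i, ∑ j, p.2 (i, j) * Real.log (p.1 i) = ∑ i, p.1 i * Real.log (p.1 i) := by
    refine Finset.sum_congr rfl fun i _ => ?_
    rw [← Finset.sum_mul, h5]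
  have e4 : ∑ i, ∑ j, p.2 (j, i) * Real.log (p.1 j) = ∑ i, p.1 i * Real.log (p.1 i) := by
    rw [Finset.sum_comm, e3]
  rw [e3, e4, Fintype.sum_prod_type]
  ring

lemma adm_isClosed {q : ℕ} :
    IsClosed {p : (Fin q → ℝ) × (Fin q × Fin q → ℝ) | IsAdmissible p} := by
  unfold IsAdmissible
  simp only [Set.ofPred_and, Set.ofPred_forall]
  refine IsClosed.inter ?_ (IsClosed.inter ?_ (IsClosed.inter ?_ (IsClosed.inter ?_ ?_)))
  · exact isClosed_iInter fun i => isClosed_le (by fun_prop) (by fun_prop)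
  · exact isClosed_eq (by fun_prop) (by fun_prop)
  · exact isClosed_iInter fun i => isClosed_le (by fun_prop) (by fun_prop)
  · exact isClosed_iInter fun i => isClosed_iInter fun j => isClosed_eq (by fun_prop) (by fun_prop)
  · exact isClosed_iInter fun i => isClosed_eq (by fun_prop) (by fun_prop)

lemma adm_isCompact {q : ℕ} :
    IsCompact {p : (Fin q → ℝ) × (Fin q × Fin q → ℝ) | IsAdmissible p} := by
  have hc : IsCompact ((Set.univ.pi fun _ : Fin q => Set.Icc (0:ℝ) 1) ×ˢ
      (Set.univ.pi fun _ : Fin q × Fin q => Set.Icc (0:ℝ) 1)) :=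
    (isCompact_univ_pi fun _ => isCompact_Icc).prod (isCompact_univ_pi fun _ => isCompact_Icc)
  refine hc.of_isClosed_subset adm_isClosed ?_
  intro p hp
  have hle := adm_le hp
  obtain ⟨h1, h2, h3, h4, h5⟩ := hp
  have hi : ∀ i, p.1 i ≤ 1 := fun i => by
    rw [← h2]; exact Finset.single_le_sum (f := p.1) (fun j _ => h1 j) (Finset.mem_univ i)
  refine ⟨fun i _ => ⟨h1 i, hi i⟩, fun a _ => ⟨h3 a, (hle a.1 a.2).trans (hi _)⟩⟩

lemma rate_sublevel_closed {q : ℕ} (μ : Fin q → ℝ) (hμ0 : ∀ i, 0 < μ i) (d : ℕ) (t : ENNReal)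
    (ht : t ≠ ⊤) : {p | rate μ d p ≤ t} = {p | IsAdmissible p} ∩
      {p | ENNReal.ofReal (rateG μ d p) ≤ t} := by
  ext p
  by_cases h : IsAdmissible p
  · simp [rate_eq μ hμ0 d h, h]
  · simp [rate, h, ht]

lemma rate_good {q : ℕ} (μ : Fin q → ℝ) (hμ0 : ∀ i, 0 < μ i) (d : ℕ) :
    (LowerSemicontinuous (rate μ d) ∧
      ∀ t : ENNReal, t ≠ ⊤ → IsCompact {p | rate μ d p ≤ t}) := by
  have hcl : ∀ t, IsClosed {p | ENNReal.ofReal (rateG μ d p) ≤ t} := fun t =>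
    isClosed_le (ENNReal.continuous_ofReal.comp (rateG_continuous μ d)) continuous_const
  constructor
  · rw [lowerSemicontinuous_iff_isClosed_preimage]
    intro t
    by_cases ht : t = ⊤
    · subst ht; simp
    · have := rate_sublevel_closed μ hμ0 d t ht
      change IsClosed {p | rate μ d p ≤ t}
      rw [this]
      exact adm_isClosed.inter (hcl t)
  · intro t ht
    rw [rate_sublevel_closed μ hμ0 d t ht]
    exact adm_isCompact.inter_right (hcl t)

/-! ### Factorials -/

lemma log_fact_lower (c : ℕ) : (c : ℝ) * Real.log c - c ≤ Real.log (c.factorial) := by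
  induction c with
  | zero => simp
  | succ c ih =>
    rcases Nat.eq_zero_or_pos c with h | h
    · subst h; simp
    rw [Nat.factorial_succ]
    push_cast
    have hc : (0:ℝ) < c := by exact_mod_cast h
    rw [Real.log_mul (by positivity) (by positivity)]
    have : Real.log ((c:ℝ) + 1) - Real.log c ≤ 1 / c := by
      rw [← Real.log_div (by positivity) (by positivity)]
      have := Real.log_le_sub_one_of_pos (show (0:ℝ) < (c + 1) / c by positivity)
      have h2 : ((c:ℝ) + 1) / c - 1 = 1 / c := by field_simp; ring
      linarith
    have h3 : (c:ℝ) * (Real.log ((c:ℝ) + 1) - Real.log c) ≤ 1 := by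
      calc _ ≤ (c:ℝ) * (1 / c) := by gcongr
        _ = 1 := by field_simp
    nlinarith

lemma log_fact_upper' (c : ℕ) : Real.log ((c+1).factorial) ≤
    ((c:ℝ)+1) * Real.log (c+1) - (c+1) + Real.log (c+1) + 1 := by
  induction c with
  | zero => simp
  | succ c ih =>
    rw [Nat.factorial_succ]
    push_cast
    rw [Real.log_mul (by positivity) (by positivity)]
    have : 1 / ((c:ℝ)+1+1) ≤ Real.log ((c:ℝ)+1+1) - Real.log (c + 1) := by
      rw [← Real.log_div (by positivity) (by positivity)]
      have := Real.one_sub_inv_le_log_of_pos (show (0:ℝ) < ((c:ℝ)+1+1) / (c+1) by positivity)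
      have h2 : 1 - (((c:ℝ)+1+1) / (c+1))⁻¹ = 1 / ((c:ℝ)+1+1) := by field_simp; ring
      linarith
    have h3 : 1 ≤ ((c:ℝ)+1+1) * (Real.log ((c:ℝ)+1+1) - Real.log (c + 1)) := by
      calc 1 = ((c:ℝ)+1+1) * (1 / ((c:ℝ)+1+1)) := by field_simp
        _ ≤ _ := by gcongr
    nlinarith

lemma log_fact_upper (c : ℕ) : Real.log (c.factorial) ≤
    (c:ℝ) * Real.log c - c + (Real.log (c+1) + 1) := by
  rcases c with _ | c
  · simp
  · have := log_fact_upper' c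
    have h2 : Real.log ((c:ℝ)+1) ≤ Real.log ((c:ℝ)+1+1) := by
      apply Real.log_le_log <;> linarith [show (0:ℝ) ≤ c by positivity]
    push_cast
    linarith

/-! ### Words and type classes -/

/-- Number of occurrences of a letter in a word. -/
def cnt {ι A : Type*} [Fintype ι] [DecidableEq A] (w : ι → A) (a : A) : ℕ :=
  (Finset.univ.filter fun k => w k = a).card

/-- The type class of a word. -/
noncomputable def typeClass {ι A : Type*} [Fintype ι] [DecidableEq ι] [Fintype A] [DecidableEq A]
    (h : ι → A) : Finset (ι → A) :=
  Finset.univ.filter fun w => ∀ a, cnt w a = cnt h a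

lemma mem_typeClass {ι A : Type*} [Fintype ι] [DecidableEq ι] [Fintype A] [DecidableEq A] {h w : ι → A} :
    w ∈ typeClass h ↔ ∀ a, cnt w a = cnt h a := by simp [typeClass]

lemma cnt_comp_perm {ι A : Type*} [Fintype ι] [DecidableEq ι] [DecidableEq A] (w : ι → A)
    (σ : Equiv.Perm ι) (a : A) : cnt (w ∘ σ) a = cnt w a := by
  unfold cnt
  refine Finset.card_bij (fun k _ => σ k) ?_ ?_ ?_
  · intro k hk; simpa using hk
  · intro k _ l _ hkl; exact σ.injective hkl
  · intro k hk; exact ⟨σ.symm k, by simpa using hk, by simp⟩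

lemma exists_perm_of_cnt {ι A : Type*} [Fintype ι] [DecidableEq ι] [DecidableEq A] (w h : ι → A)
    (hc : ∀ a, cnt w a = cnt h a) : ∃ κ : Equiv.Perm ι, w = h ∘ κ := by
  have he : ∀ a, Nonempty ({k // w k = a} ≃ {k // h k = a}) := by
    intro a
    apply Fintype.card_eq.mp
    rw [Fintype.card_subtype, Fintype.card_subtype]
    exact hc a
  let e := fun a => (he a).some
  refine ⟨(Equiv.sigmaFiberEquiv w).symm.trans
    ((Equiv.sigmaCongrRight e).trans (Equiv.sigmaFiberEquiv h)), ?_⟩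
  funext k
  have := (e (w k) ⟨k, rfl⟩).2
  exact this.symm

/-- Number of permutations fixing a word. -/
noncomputable def stabNum {ι A : Type*} [Fintype ι] [DecidableEq ι] (h : ι → A) : ℕ :=
  (Finset.univ.filter fun σ : Equiv.Perm ι => h ∘ σ = h).card

lemma card_perm_to {ι A : Type*} [Fintype ι] [DecidableEq ι] [DecidableEq A] (w h : ι → A)
    (hc : ∀ a, cnt w a = cnt h a) :
    (Finset.univ.filter fun σ : Equiv.Perm ι => h ∘ σ = w).card = stabNum h := by
  obtain ⟨κ, rfl⟩ := exists_perm_of_cnt w h hc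
  unfold stabNum
  refine Finset.card_bij (fun σ _ => σ * κ⁻¹) ?_ ?_ ?_
  · intro σ hσ
    simp only [Finset.mem_filter, Finset.mem_univ, true_and] at hσ ⊢
    funext k
    have := congrFun hσ (κ⁻¹ k)
    simpa using this
  · intro σ _ τ _ h; simpa using h
  · intro σ hσ
    simp only [Finset.mem_filter, Finset.mem_univ, true_and] at hσ
    refine ⟨σ * κ, ?_, by simp⟩
    simp only [Finset.mem_filter, Finset.mem_univ, true_and]
    funext k
    have := congrFun hσ (κ k)
    simpa using this

lemma sum_perm {ι A : Type*} [Fintype ι] [DecidableEq ι] [Fintype A] [DecidableEq A] (h : ι → A)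
    (g : (ι → A) → ℝ) :
    ∑ σ : Equiv.Perm ι, g (h ∘ σ) = stabNum h * ∑ w ∈ typeClass h, g w := by
  rw [← Finset.sum_fiberwise_of_maps_to (s := Finset.univ) (t := typeClass h)
    (g := fun σ : Equiv.Perm ι => h ∘ σ), Finset.mul_sum]
  · refine Finset.sum_congr rfl fun w hw => ?_
    rw [Finset.sum_congr rfl (g := fun _ => g w), Finset.sum_const, nsmul_eq_mul, card_perm_to]
    · simpa [typeClass] using hw
    · intro σ hσ
      rw [(Finset.mem_filter.mp hσ).2]
  · intro σ _
    simp [typeClass, cnt_comp_perm]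

lemma stab_mul {ι A : Type*} [Fintype ι] [DecidableEq ι] [Fintype A] [DecidableEq A] (h : ι → A) :
    ((Fintype.card ι).factorial : ℝ) = stabNum h * (typeClass h).card := by
  have := sum_perm h (fun _ => 1)
  simpa [Fintype.card_perm] using this

lemma stabNum_eq {ι A : Type*} [Fintype ι] [DecidableEq ι] [Fintype A] [DecidableEq A] (h : ι → A) :
    stabNum h = ∏ a, (cnt h a).factorial := by
  have := DomMulAct.stabilizer_card h
  rw [Fintype.card_subtype] at this
  unfold stabNum
  refine Eq.trans ?_ (this.trans ?_)
  · congr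
  refine Finset.prod_congr rfl fun a _ => ?_
  rw [Fintype.card_subtype]
  rfl

lemma sum_cnt {ι A : Type*} [Fintype ι] [DecidableEq ι] [Fintype A] [DecidableEq A] (h : ι → A) :
    ∑ a, cnt h a = Fintype.card ι := by
  unfold cnt
  rw [← Finset.card_univ, Finset.card_eq_sum_card_fiberwise (f := h) (t := Finset.univ)]
  intro; simp

lemma cnt_le {ι A : Type*} [Fintype ι] [DecidableEq ι] [DecidableEq A] (h : ι → A) (a : A) :
    cnt h a ≤ Fintype.card ι := Finset.card_filter_le _ _

lemma mem_typeClass_self {ι A : Type*} [Fintype ι] [DecidableEq ι] [Fintype A] [DecidableEq A] (h : ι → A) :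
    h ∈ typeClass h := by simp [typeClass]

lemma typeClass_pos {ι A : Type*} [Fintype ι] [DecidableEq ι] [Fintype A] [DecidableEq A] (h : ι → A) :
    (0 : ℝ) < (typeClass h).card := by
  exact_mod_cast Finset.card_pos.mpr ⟨h, mem_typeClass_self h⟩

/-- Entropy functional of counts. -/
noncomputable def cent {A : Type*} [Fintype A] (m : ℕ) (c : A → ℕ) : ℝ :=
  m * ∑ a, ((c a : ℝ) / m) * Real.log ((c a : ℝ) / m)

lemma cent_eq {A : Type*} [Fintype A] (m : ℕ) (hm : 0 < m) (c : A → ℕ) (hc : ∑ a, c a = m) :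
    cent m c = ∑ a, (c a : ℝ) * Real.log (c a) - m * Real.log m := by
  unfold cent
  have hm' : (m:ℝ) ≠ 0 := by positivity
  have : (m:ℝ) * Real.log m = ∑ a, (c a : ℝ) * Real.log m := by
    rw [← Finset.sum_mul]; congr 1; exact_mod_cast hc.symm
  rw [this, ← Finset.sum_sub_distrib, Finset.mul_sum]
  refine Finset.sum_congr rfl fun a _ => ?_
  rcases Nat.eq_zero_or_pos (c a) with h | h
  · simp [h]
  · rw [Real.log_div (by positivity) hm']
    field_simp

lemma typeClass_lower {ι A : Type*} [Fintype ι] [DecidableEq ι] [Fintype A] [DecidableEq A] (h : ι → A)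
    (m : ℕ) (hm : Fintype.card ι = m) (hpos : 0 < m) :
    Real.exp (-cent m (cnt h) - Fintype.card A * (Real.log (m + 1) + 1)) ≤
      (typeClass h).card := by
  rw [← Real.le_log_iff_exp_le (typeClass_pos h)]
  have h1 := stab_mul h
  rw [stabNum_eq, hm] at h1
  have hsum : ∑ a, cnt h a = m := by rw [sum_cnt, hm]
  rw [cent_eq m hpos _ hsum]
  have h2 := congrArg Real.log h1
  rw [Real.log_mul (by
    have : 0 < ∏ a, (cnt h a).factorial := Finset.prod_pos fun a _ => Nat.factorial_pos _
    positivity) (typeClass_pos h).ne'] at h2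
  push_cast at h2
  rw [Real.log_prod (by intro a _; positivity)] at h2
  have h3 := log_fact_lower m
  have h4 : ∑ a, Real.log ((cnt h a).factorial : ℝ) ≤
      ∑ a, ((cnt h a : ℝ) * Real.log (cnt h a) - cnt h a + (Real.log (m + 1) + 1)) := by
    refine Finset.sum_le_sum fun a _ => ?_
    have := log_fact_upper (cnt h a)
    have h5 : Real.log ((cnt h a : ℝ) + 1) ≤ Real.log (m + 1) := by
      apply Real.log_le_log (by positivity)
      have : cnt h a ≤ m := hm ▸ cnt_le h a
      have : (cnt h a : ℝ) ≤ m := by exact_mod_cast this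
      linarith
    linarith
  rw [Finset.sum_add_distrib, Finset.sum_sub_distrib, Finset.sum_const, Finset.card_univ,
    nsmul_eq_mul] at h4
  have h6 : ∑ a, (cnt h a : ℝ) = m := by exact_mod_cast hsum
  linarith

lemma sum_log_word {ι A : Type*} [Fintype ι] [DecidableEq ι] [Fintype A] [DecidableEq A] (w : ι → A)
    (g : A → ℝ) : ∑ k, g (w k) = ∑ a, (cnt w a : ℝ) * g a := by
  rw [← Finset.sum_fiberwise_of_maps_to (s := Finset.univ) (t := Finset.univ) (g := w)
    (fun _ _ => Finset.mem_univ _)]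
  refine Finset.sum_congr rfl fun a _ => ?_
  rw [Finset.sum_congr rfl (g := fun _ => g a), Finset.sum_const, nsmul_eq_mul]
  · rfl
  · intro k hk; rw [(Finset.mem_filter.mp hk).2]

lemma prod_word {ι A : Type*} [Fintype ι] [DecidableEq ι] [Fintype A] [DecidableEq A] (w : ι → A)
    (g : A → ℝ) (hg : ∀ k, 0 < g (w k)) :
    ∏ k, g (w k) = Real.exp (∑ a, (cnt w a : ℝ) * Real.log (g a)) := by
  rw [← sum_log_word w fun a => Real.log (g a), Real.exp_sum]
  exact Finset.prod_congr rfl fun k _ => (Real.exp_log (hg k)).symm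

lemma cnt_pos {ι A : Type*} [Fintype ι] [DecidableEq ι] [DecidableEq A] (w : ι → A) (k : ι) :
    0 < cnt w (w k) := Finset.card_pos.mpr ⟨k, by simp⟩

lemma prod_emp {ι A : Type*} [Fintype ι] [DecidableEq ι] [Fintype A] [DecidableEq A] (w : ι → A)
    (m : ℕ) (hpos : 0 < m) :
    ∏ k, ((cnt w (w k) : ℝ) / m) = Real.exp (cent m (cnt w)) := by
  rw [prod_word w (fun a => (cnt w a : ℝ) / m)]
  · congr 1
    unfold cent
    rw [Finset.mul_sum]
    refine Finset.sum_congr rfl fun a _ => ?_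
    field_simp
  · intro k
    have := cnt_pos w k
    positivity

lemma sum_prod_word {ι A : Type*} [Fintype ι] [DecidableEq ι] [Fintype A] (g : A → ℝ) :
    ∑ w : ι → A, ∏ k, g (w k) = (∑ a, g a) ^ Fintype.card ι := by
  rw [← Finset.card_univ, ← Finset.prod_const, Finset.prod_univ_sum]
  simp

lemma typeClass_upper {ι A : Type*} [Fintype ι] [DecidableEq ι] [Fintype A] [DecidableEq A] (h : ι → A)
    (m : ℕ) (hm : Fintype.card ι = m) (hpos : 0 < m) :
    ((typeClass h).card : ℝ) ≤ Real.exp (-cent m (cnt h)) := by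
  have h1 : ∑ w ∈ typeClass h, ∏ k, ((cnt h (w k) : ℝ) / m) ≤ 1 := by
    calc _ ≤ ∑ w : ι → A, ∏ k, ((cnt h (w k) : ℝ) / m) :=
          Finset.sum_le_sum_of_subset_of_nonneg (Finset.subset_univ _)
            (fun _ _ _ => Finset.prod_nonneg fun _ _ => by positivity)
      _ = 1 := by
          rw [sum_prod_word (fun a => (cnt h a : ℝ) / m), ← Finset.sum_div]
          have : ∑ a, (cnt h a : ℝ) = m := by rw [← hm]; exact_mod_cast sum_cnt h
          rw [this, div_self (by positivity), one_pow]
  have h2 : ∀ w ∈ typeClass h, ∏ k, ((cnt h (w k) : ℝ) / m) = Real.exp (cent m (cnt h)) := by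
    intro w hw
    have : cnt w = cnt h := by
      funext a; simpa using (Finset.mem_filter.mp hw).2 a
    rw [← this, prod_emp w m hpos]
  rw [Finset.sum_congr rfl h2, Finset.sum_const, nsmul_eq_mul] at h1
  rw [Real.exp_neg]
  rwa [← one_div, le_div_iff₀ (Real.exp_pos _)]

lemma sum_types {ι A : Type*} [Fintype ι] [DecidableEq ι] [Fintype A] [DecidableEq A]
    (c : (ι → A) → A → ℕ) (M : ℕ) (hM : 0 < M) (hc : ∀ w, ∑ a, c w a = M) :
    ∑ w : ι → A, ∏ k, ((c w (w k) : ℝ) / M) ≤ ((M:ℝ) + 1) ^ Fintype.card A := by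
  have hmaps : ∀ w ∈ (Finset.univ : Finset (ι → A)), c w ∈ Finset.univ.image c := by
    intro w _; exact Finset.mem_image_of_mem _ (Finset.mem_univ w)
  rw [← Finset.sum_fiberwise_of_maps_to hmaps]
  calc _ ≤ ∑ s ∈ Finset.univ.image c, (1:ℝ) := by
        refine Finset.sum_le_sum fun s hs => ?_
        obtain ⟨w', _, rfl⟩ := Finset.mem_image.mp hs
        calc _ = ∑ w with c w = c w', ∏ k, ((c w' (w k) : ℝ) / M) := by
              refine Finset.sum_congr rfl fun w hw => ?_
              rw [(Finset.mem_filter.mp hw).2]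
          _ ≤ ∑ w : ι → A, ∏ k, ((c w' (w k) : ℝ) / M) :=
              Finset.sum_le_sum_of_subset_of_nonneg (Finset.subset_univ _)
                (fun _ _ _ => Finset.prod_nonneg fun _ _ => by positivity)
          _ = 1 := by
              rw [sum_prod_word (fun a => (c w' a : ℝ) / M), ← Finset.sum_div]
              have : ∑ a, (c w' a : ℝ) = M := by exact_mod_cast hc w'
              rw [this, div_self (by positivity), one_pow]
    _ = ((Finset.univ.image c).card : ℝ) := by simp
    _ ≤ ((Fintype.piFinset fun _ : A => Finset.range (M+1)).card : ℝ) := by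
        norm_cast
        apply Finset.card_le_card
        intro s hs
        obtain ⟨w', _, rfl⟩ := Finset.mem_image.mp hs
        rw [Fintype.mem_piFinset]
        intro a
        rw [Finset.mem_range, Nat.lt_succ_iff, ← hc w']
        exact Finset.single_le_sum (f := c w') (fun _ _ => Nat.zero_le _) (Finset.mem_univ a)
    _ = _ := by simp

/-- Every count vector is realised by a word. -/
lemma exists_word {ι A : Type*} [Fintype ι] [DecidableEq ι] [Fintype A] [DecidableEq A] (c : A → ℕ)
    (hc : ∑ a, c a = Fintype.card ι) : ∃ w : ι → A, ∀ a, cnt w a = c a := by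
  have : Fintype.card ι = Fintype.card (Σ a, Fin (c a)) := by simp [hc]
  obtain ⟨e⟩ := Fintype.card_eq.mp this
  refine ⟨fun k => (e k).1, fun a => ?_⟩
  unfold cnt
  rw [← Fintype.card_subtype]
  have e2 : {k // (e k).1 = a} ≃ {s : Σ a, Fin (c a) // s.1 = a} :=
    e.subtypeEquiv (fun k => Iff.rfl)
  rw [Fintype.card_congr e2, Fintype.card_congr (Equiv.sigmaSubtype a), Fintype.card_fin]

/-! ### Pairings -/

lemma pairings_isConj {N : ℕ} {f g : Equiv.Perm (Fin N)} (hf : f ∈ pairings N)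
    (hg : g ∈ pairings N) : ∃ κ : Equiv.Perm (Fin N), κ * f * κ⁻¹ = g := by
  have key : ∀ f ∈ pairings N, ∃ k, f.cycleType = Multiset.replicate k 2 ∧ 2 * k = N := by
    intro f hf
    simp only [pairings, Finset.mem_filter, Finset.mem_univ, true_and] at hf
    have h2 : f ^ 2 = 1 := by ext p; simp [pow_two, hf.1]
    have := Fact.mk Nat.prime_two
    have h3 : f.cycleType = Multiset.replicate (Multiset.card f.cycleType) 2 :=
      Multiset.eq_replicate.mpr ⟨rfl, Equiv.Perm.pow_prime_eq_one_iff.mp h2⟩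
    refine ⟨_, h3, ?_⟩
    have h4 := Equiv.Perm.sum_cycleType f
    rw [h3] at h4
    have h5 : f.support = Finset.univ := by ext p; simp [hf.2]
    rw [h5] at h4
    simp at h4
    omega
  obtain ⟨k, hk, hk'⟩ := key f hf
  obtain ⟨l, hl, hl'⟩ := key g hg
  have : k = l := by omega
  subst this
  have := Equiv.Perm.isConj_iff_cycleType_eq.mpr (hk.trans hl.symm)
  exact isConj_iff.mp this

lemma conj_mem_pairings {N : ℕ} {f : Equiv.Perm (Fin N)} (hf : f ∈ pairings N)
    (κ : Equiv.Perm (Fin N)) : κ * f * κ⁻¹ ∈ pairings N := by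
  simp only [pairings, Finset.mem_filter, Finset.mem_univ, true_and] at hf ⊢
  refine ⟨fun p => by simp [hf.1], fun p hp => hf.2 (κ⁻¹ p) ?_⟩
  simp only [Equiv.Perm.mul_apply] at hp
  exact (κ.injective (by simpa using hp))

lemma sum_pairings {N : ℕ} {f₀ : Equiv.Perm (Fin N)} (hf₀ : f₀ ∈ pairings N)
    (g : Equiv.Perm (Fin N) → ℝ) :
    (N.factorial : ℝ) * ∑ f ∈ pairings N, g f =
      (pairings N).card * ∑ σ : Equiv.Perm (Fin N), g (σ * f₀ * σ⁻¹) := by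
  have h1 : ∀ τ : Equiv.Perm (Fin N), ∑ f ∈ pairings N, g f =
      ∑ f ∈ pairings N, g (τ * f * τ⁻¹) := by
    intro τ
    symm
    refine Finset.sum_bij (fun f _ => τ * f * τ⁻¹) (fun f hf => conj_mem_pairings hf τ) ?_ ?_ ?_
    · intro a _ b _ h; simpa using h
    · intro f hf
      exact ⟨τ⁻¹ * f * τ, by simpa using conj_mem_pairings hf τ⁻¹, by simp [mul_assoc]⟩
    · intros; rfl
  have h2 : (N.factorial : ℝ) * ∑ f ∈ pairings N, g f =
      ∑ τ : Equiv.Perm (Fin N), ∑ f ∈ pairings N, g (τ * f * τ⁻¹) := by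
    rw [Finset.sum_congr rfl fun τ _ => (h1 τ).symm]
    simp [Fintype.card_perm]
  rw [h2, Finset.sum_comm]
  rw [Finset.sum_congr rfl (g := fun _ => ∑ σ : Equiv.Perm (Fin N), g (σ * f₀ * σ⁻¹))]
  · simp
  · intro f hf
    obtain ⟨κ, rfl⟩ := pairings_isConj hf₀ hf
    refine Fintype.sum_equiv (Equiv.mulRight κ) _ _ fun τ => ?_
    simp [mul_assoc]

/-! ### The key identity -/

/-- Spin of the vertex to which a half-edge is attached. -/
def halfSpin {q n d : ℕ} (η : Fin n → Fin q) (p : Fin (n * d)) : Fin q :=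
  η ⟨p.val / d, Nat.div_lt_of_lt_mul (Nat.mul_comm n d ▸ p.isLt)⟩

/-- Number of half-edges with given spin, paired to a half-edge with given spin. -/
def bondCnt {q N : ℕ} (f : Equiv.Perm (Fin N)) (w : Fin N → Fin q) (a : Fin q × Fin q) : ℕ :=
  (Finset.univ.filter fun p : Fin N => w p = a.1 ∧ w (f p) = a.2).card

/-- Splitting the half-edges into two halves. -/
def halves {N m : ℕ} (hN : N = m + m) : Fin m ⊕ Fin m ≃ Fin N :=
  finSumFinEquiv.trans (finCongr hN.symm)

/-- Reference pairing. -/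
def refPair {N m : ℕ} (hN : N = m + m) : Equiv.Perm (Fin N) :=
  (halves hN).permCongr (Equiv.sumComm _ _)

lemma refPair_apply {N m : ℕ} (hN : N = m + m) (x : Fin m ⊕ Fin m) :
    refPair hN (halves hN x) = halves hN x.swap := by
  simp [refPair, Equiv.permCongr_apply]

lemma refPair_mem {N m : ℕ} (hN : N = m + m) : refPair hN ∈ pairings N := by
  simp only [pairings, Finset.mem_filter, Finset.mem_univ, true_and]
  constructor
  · intro p
    obtain ⟨x, rfl⟩ := (halves hN).surjective p
    simp [refPair_apply]
  · intro p
    obtain ⟨x, rfl⟩ := (halves hN).surjective p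
    rw [refPair_apply]
    intro h
    have := (halves hN).injective h
    rcases x with x | x <;> simp at this

/-- The word of pairs attached to a word of half-edges. -/
def pairWord {q N m : ℕ} (hN : N = m + m) (w : Fin N → Fin q) (k : Fin m) : Fin q × Fin q :=
  (w (halves hN (Sum.inl k)), w (halves hN (Sum.inr k)))

lemma pairWord_bij {q N m : ℕ} (hN : N = m + m) :
    Function.Bijective (pairWord (q := q) hN) := by
  constructor
  · intro w w' h
    funext p
    obtain ⟨x, rfl⟩ := (halves hN).surjective p
    rcases x with x | x
    · exact congrArg Prod.fst (congrFun h x)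
    · exact congrArg Prod.snd (congrFun h x)
  · intro u
    refine ⟨fun p => Sum.elim (fun k => (u k).1) (fun k => (u k).2) ((halves hN).symm p), ?_⟩
    funext k
    simp [pairWord]

lemma bondCnt_refPair {q N m : ℕ} (hN : N = m + m) (w : Fin N → Fin q) (a : Fin q × Fin q) :
    bondCnt (refPair hN) w a = cnt (pairWord hN w) a + cnt (pairWord hN w) a.swap := by
  unfold bondCnt cnt
  rw [Finset.card_filter, Finset.card_filter, Finset.card_filter, ← (halves hN).sum_comp,
    Fintype.sum_sum_type]
  simp only [refPair_apply, pairWord, Prod.ext_iff, Sum.swap_inl, Sum.swap_inr, Prod.fst_swap,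
    Prod.snd_swap]
  congr 1
  refine Finset.sum_congr rfl fun k _ => ?_
  simp [and_comm]

lemma bondCnt_conj {q N : ℕ} (f σ : Equiv.Perm (Fin N)) (w : Fin N → Fin q)
    (a : Fin q × Fin q) : bondCnt (σ * f * σ⁻¹) w a = bondCnt f (w ∘ σ) a := by
  unfold bondCnt
  rw [Finset.card_filter, Finset.card_filter, ← Equiv.sum_comp σ]
  simp

lemma sum_bondCnt {q N : ℕ} (f : Equiv.Perm (Fin N)) (w : Fin N → Fin q) (i : Fin q) :
    ∑ j, bondCnt f w (i, j) = cnt w i := by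
  unfold bondCnt cnt
  rw [Finset.card_eq_sum_card_fiberwise (f := fun p => w (f p)) (t := Finset.univ)]
  · simp [Finset.filter_filter]
  · intro; simp

lemma cnt_halfSpin {q n d : ℕ} (η : Fin n → Fin q) (a : Fin q) :
    cnt (halfSpin (d := d) η) a = d * cnt η a := by
  unfold cnt
  rw [Finset.card_filter, Finset.card_filter, ← finProdFinEquiv.sum_comp,
    Fintype.sum_prod_type, Finset.mul_sum]
  refine Finset.sum_congr rfl fun i _ => ?_
  have : ∀ j : Fin d, halfSpin η (finProdFinEquiv (i, j)) = η i := by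
    intro j
    unfold halfSpin
    congr 1
    apply Fin.ext
    have hd : 0 < d := j.pos
    simp [finProdFinEquiv, Nat.add_mul_div_left _ _ hd]
  simp [this]

/-- Bond measure of a word of half-edges. -/
noncomputable def bondM {q n d m : ℕ} (hN : n * d = m + m) (w : Fin (n * d) → Fin q) :
    Fin q × Fin q → ℝ := fun a => (bondCnt (refPair hN) w a : ℝ) / (n * d)

lemma configProb_eq {q n d m : ℕ} (hN : n * d = m + m) (μ : Fin q → ℝ)
    (F : Set ((Fin q → ℝ) × (Fin q × Fin q → ℝ))) :
    configProb q n d μ F = ∑ η : Fin n → Fin q, ∑ w ∈ typeClass (halfSpin (d := d) η),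
      (∏ i, μ (η i)) / (typeClass (halfSpin (d := d) η)).card *
        (if (empSpin q n η, bondM hN w) ∈ F then 1 else 0) := by
  unfold configProb
  have hp : (0:ℝ) < (pairings (n * d)).card := by
    exact_mod_cast Finset.card_pos.mpr ⟨_, refPair_mem hN⟩
  have hfac : (0:ℝ) < ((n * d).factorial : ℝ) := by positivity
  have h1 := sum_pairings (refPair_mem hN) (fun f => ∑ η : Fin n → Fin q,
      (∏ i, μ (η i)) * (if (empSpin q n η, empBond q n d η f) ∈ F then (1:ℝ) else 0))
  rw [Finset.sum_comm (s := (Finset.univ : Finset (Equiv.Perm (Fin (n * d)))))] at h1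
  have h2 : ∀ η : Fin n → Fin q, ∑ σ : Equiv.Perm (Fin (n * d)), (∏ i, μ (η i)) *
      (if (empSpin q n η, empBond q n d η (σ * refPair hN * σ⁻¹)) ∈ F then (1:ℝ) else 0) =
      ((n * d).factorial : ℝ) * ∑ w ∈ typeClass (halfSpin (d := d) η),
      (∏ i, μ (η i)) / (typeClass (halfSpin (d := d) η)).card *
        (if (empSpin q n η, bondM hN w) ∈ F then 1 else 0) := by
    intro η
    have h3 := sum_perm (halfSpin (d := d) η) (fun w => (∏ i, μ (η i)) *
      (if (empSpin q n η, bondM hN w) ∈ F then (1:ℝ) else 0))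
    have h4 : ∀ σ, empBond q n d η (σ * refPair hN * σ⁻¹) =
        bondM hN (halfSpin (d := d) η ∘ σ) := by
      intro σ
      funext a
      unfold bondM
      rw [← bondCnt_conj]
      rfl
    refine (Finset.sum_congr rfl fun σ _ => by rw [h4 σ]).trans (h3.trans ?_)
    have h5 := stab_mul (halfSpin (d := d) η)
    rw [Fintype.card_fin] at h5
    have h6 := typeClass_pos (halfSpin (d := d) η)
    rw [h5, Finset.mul_sum, Finset.mul_sum]
    refine Finset.sum_congr rfl fun w _ => ?_
    field_simp
  rw [Finset.sum_congr rfl fun η _ => h2 η, ← Finset.mul_sum] at h1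
  rw [div_eq_iff hp.ne']
  apply mul_left_cancel₀ hfac.ne'
  rw [h1]
  ring

lemma adm_emp {q n d m : ℕ} (hN : n * d = m + m) (hn : 0 < n) (hd : 0 < d)
    (η : Fin n → Fin q) (w : Fin (n * d) → Fin q) (hw : w ∈ typeClass (halfSpin (d := d) η)) :
    IsAdmissible (empSpin q n η, bondM hN w) := by
  have hn' : (n:ℝ) ≠ 0 := by positivity
  have hd' : (d:ℝ) ≠ 0 := by positivity
  refine ⟨fun i => ?_, ?_, fun a => ?_, fun i j => ?_, fun i => ?_⟩
  · simp only [empSpin]; positivity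
  · have : ∑ i, ((cnt η i : ℕ) : ℝ) = n := by
      have := sum_cnt η
      rw [Fintype.card_fin] at this
      exact_mod_cast this
    change ∑ i, ((cnt η i : ℕ) : ℝ) / n = 1
    rw [← Finset.sum_div, this, div_self hn']
  · simp only [bondM]; positivity
  · simp only [bondM, bondCnt_refPair, Prod.swap_prod_mk, add_comm]
  · change ∑ j, (bondCnt (refPair hN) w (i, j) : ℝ) / (n * d) = (cnt η i : ℝ) / n
    have h1 := sum_bondCnt (refPair hN) w i
    rw [mem_typeClass.mp hw i, cnt_halfSpin] at h1
    have h2 : ∑ j, (bondCnt (refPair hN) w (i, j) : ℝ) = d * cnt η i := by exact_mod_cast h1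
    rw [← Finset.sum_div, h2]
    field_simp

lemma cent_mul {A : Type*} [Fintype A] (n d : ℕ) (hd : 0 < d) (c c' : A → ℕ)
    (h : ∀ a, c' a = d * c a) : cent (n * d) c' = d * cent n c := by
  unfold cent
  have hd' : (d:ℝ) ≠ 0 := by positivity
  have : ∀ a, ((c' a : ℝ) / ((n * d : ℕ) : ℝ)) = (c a : ℝ) / n := by
    intro a
    rw [h]; push_cast
    rw [mul_comm (n:ℝ), mul_div_mul_left _ _ hd']
  simp only [this]
  push_cast
  ring

lemma n_rateG {q n d : ℕ} (hn : 0 < n) (μ : Fin q → ℝ) (c : Fin q → ℕ)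
    (ν : Fin q × Fin q → ℝ) :
    (n:ℝ) * rateG μ d ((fun a => (c a : ℝ) / n), ν) =
      -(∑ a, (c a : ℝ) * Real.log (μ a)) + (1 - d) * cent n c +
        (n:ℝ) * d / 2 * ∑ a, ν a * Real.log (ν a) := by
  have hn' : (n:ℝ) ≠ 0 := by positivity
  unfold rateG cent
  have : ∑ a, (c a : ℝ) * Real.log (μ a) = n * ∑ a, (c a : ℝ) / n * Real.log (μ a) := by
    rw [Finset.mul_sum]
    refine Finset.sum_congr rfl fun a _ => ?_
    field_simp
  rw [this]
  simp only
  ring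

lemma prod_pairs {q n d m : ℕ} (hN : n * d = m + m) (hn : 0 < n) (hd : 0 < d)
    (w : Fin (n * d) → Fin q) :
    ∏ k, ((bondCnt (refPair hN) w (pairWord hN w k) : ℝ) / ((n * d : ℕ) : ℝ)) =
      Real.exp ((n:ℝ) * d / 2 * ∑ a, bondM hN w a * Real.log (bondM hN w a)) := by
  rw [prod_word (pairWord hN w) (fun a => (bondCnt (refPair hN) w a : ℝ) / ((n * d : ℕ) : ℝ))]
  · congr 1
    have hB : ∀ a, (bondCnt (refPair hN) w a : ℝ) / ((n * d : ℕ) : ℝ) = bondM hN w a := by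
      intro a; simp [bondM]
    simp only [hB]
    have hsw : ∀ a, bondM hN w a.swap = bondM hN w a := by
      intro a; simp only [bondM, bondCnt_refPair, Prod.swap_swap, add_comm]
    have h1 : ∑ a, (cnt (pairWord hN w) a.swap : ℝ) * Real.log (bondM hN w a) =
        ∑ a, (cnt (pairWord hN w) a : ℝ) * Real.log (bondM hN w a) := by
      rw [← (Equiv.prodComm (Fin q) (Fin q)).sum_comp]
      refine Finset.sum_congr rfl fun a _ => ?_
      simp [hsw]
    have h2 : (n:ℝ) * d / 2 * ∑ a, bondM hN w a * Real.log (bondM hN w a) =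
        (1/2) * ∑ a, ((cnt (pairWord hN w) a : ℝ) + (cnt (pairWord hN w) a.swap : ℝ)) *
          Real.log (bondM hN w a) := by
      rw [Finset.mul_sum, Finset.mul_sum]
      refine Finset.sum_congr rfl fun a _ => ?_
      have : (n:ℝ) * d * bondM hN w a =
        (cnt (pairWord hN w) a : ℝ) + (cnt (pairWord hN w) a.swap : ℝ) := by
        unfold bondM
        rw [bondCnt_refPair]
        push_cast
        field_simp
      rw [← this]; ring
    rw [h2]
    simp only [add_mul, Finset.sum_add_distrib, h1]
    ring
  · intro k
    have h1 := cnt_pos (pairWord hN w) k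
    have h2 : 0 < bondCnt (refPair hN) w (pairWord hN w k) := by rw [bondCnt_refPair]; omega
    positivity

/-- Logarithmic error term. -/
noncomputable def errL (n d : ℕ) : ℝ := Real.log ((n * d : ℕ) + 1) + 1

lemma upper_real {q n d m : ℕ} (hN : n * d = m + m) (hn : 0 < n) (hd : 0 < d)
    (μ : Fin q → ℝ) (hμ0 : ∀ i, 0 < μ i)
    (F : Set ((Fin q → ℝ) × (Fin q × Fin q → ℝ))) (J : ℝ)
    (hJ : ∀ x ∈ F, IsAdmissible x → J ≤ rateG μ d x) :
    configProb q n d μ F ≤ Real.exp (-(n * J) + (q + q + q * q : ℕ) * errL n d) := by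
  have hNpos : 0 < n * d := Nat.mul_pos hn hd
  have hterm : ∀ η : Fin n → Fin q, ∀ w ∈ typeClass (halfSpin (d := d) η),
      (∏ i, μ (η i)) / (typeClass (halfSpin (d := d) η)).card *
        (if (empSpin q n η, bondM hN w) ∈ F then 1 else 0) ≤
      Real.exp (-(n * J) + q * errL n d) * ((∏ i, ((cnt η (η i) : ℝ) / n)) *
        ∏ k, ((bondCnt (refPair hN) w (pairWord hN w k) : ℝ) / ((n * d : ℕ) : ℝ))) := by
    intro η w hw
    by_cases hF : (empSpin q n η, bondM hN w) ∈ F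
    · rw [if_pos hF, mul_one]
      have hadm := adm_emp hN hn hd η w hw
      have hG := hJ _ hF hadm
      have hnG := n_rateG (d := d) hn μ (cnt η) (bondM hN w)
      have hG' : (n:ℝ) * J ≤ n * rateG μ d ((fun a => (cnt η a : ℝ) / n), bondM hN w) := by
        have : (empSpin q n η) = fun a => (cnt η a : ℝ) / n := rfl
        rw [← this]
        gcongr
      have hlow := typeClass_lower (halfSpin (d := d) η) (n * d) (by simp) hNpos
      rw [cent_mul n d hd (cnt η) _ (fun a => cnt_halfSpin η a), Fintype.card_fin] at hlow
      rw [prod_word η μ (fun k => hμ0 _), prod_emp η n hn, prod_pairs hN hn hd w,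
        ← Real.exp_add, ← Real.exp_add, div_le_iff₀ (typeClass_pos _)]
      refine le_trans ?_ (mul_le_mul_of_nonneg_left hlow (Real.exp_pos _).le)
      rw [← Real.exp_add, Real.exp_le_exp]
      unfold errL
      nlinarith
    · rw [if_neg hF, mul_zero]
      positivity
  rw [configProb_eq hN]
  have hL0 : (0:ℝ) < ((n * d : ℕ) : ℝ) + 1 := by positivity
  have hexp : ((n * d : ℕ) : ℝ) + 1 ≤ Real.exp (errL n d) := by
    unfold errL
    rw [Real.exp_add, Real.exp_log hL0]
    have := Real.one_le_exp (show (0:ℝ) ≤ 1 by norm_num)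
    nlinarith
  calc _ ≤ ∑ η : Fin n → Fin q, ∑ w : Fin (n * d) → Fin q,
      Real.exp (-(n * J) + q * errL n d) * ((∏ i, ((cnt η (η i) : ℝ) / n)) *
        ∏ k, ((bondCnt (refPair hN) w (pairWord hN w k) : ℝ) / ((n * d : ℕ) : ℝ))) := by
        refine Finset.sum_le_sum fun η _ => ?_
        refine (Finset.sum_le_sum (hterm η)).trans ?_
        refine Finset.sum_le_sum_of_subset_of_nonneg (Finset.subset_univ _) fun w _ _ => ?_
        positivity
    _ = Real.exp (-(n * J) + q * errL n d) *
        ((∑ η : Fin n → Fin q, ∏ i, ((cnt η (η i) : ℝ) / n)) *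
        ∑ w : Fin (n * d) → Fin q,
          ∏ k, ((bondCnt (refPair hN) w (pairWord hN w k) : ℝ) / ((n * d : ℕ) : ℝ))) := by
        rw [Finset.sum_mul_sum, Finset.mul_sum]
        simp only [Finset.mul_sum]
    _ ≤ Real.exp (-(n * J) + q * errL n d) *
        (Real.exp (q * errL n d) * Real.exp ((q * q : ℕ) * errL n d)) := by
        gcongr
        · have hs : ∀ η : Fin n → Fin q, ∑ a, cnt η a = n := fun η => by
            rw [sum_cnt, Fintype.card_fin]
          refine (sum_types (fun η => cnt η) n hn hs).trans ?_
          rw [Fintype.card_fin, Real.exp_nat_mul]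
          gcongr
          refine le_trans ?_ hexp
          have : n ≤ n * d := Nat.le_mul_of_pos_right n hd
          have : (n:ℝ) ≤ ((n * d : ℕ) : ℝ) := by exact_mod_cast this
          linarith
        · let E := Equiv.ofBijective _ (pairWord_bij (q := q) hN)
          have hE : ∀ w, pairWord hN w = E w := fun w => rfl
          have h1 := E.symm.sum_comp (fun w : Fin (n * d) → Fin q =>
            ∏ k, ((bondCnt (refPair hN) w (pairWord hN w k) : ℝ) / ((n * d : ℕ) : ℝ)))
          rw [← h1]
          simp only [hE, Equiv.apply_symm_apply]
          refine (sum_types (fun u => bondCnt (refPair hN) (E.symm u)) (n * d) hNpos ?_).trans ?_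
          · intro u
            rw [Fintype.sum_prod_type]
            simp only [sum_bondCnt]
            rw [sum_cnt, Fintype.card_fin]
          · rw [Fintype.card_prod, Fintype.card_fin, Real.exp_nat_mul]
            gcongr
    _ = _ := by
        rw [← Real.exp_add, ← Real.exp_add]
        congr 1
        push_cast
        ring

lemma lower_real {q n d m : ℕ} (hN : n * d = m + m) (hn : 0 < n) (hd : 0 < d)
    (μ : Fin q → ℝ) (hμ0 : ∀ i, 0 < μ i)
    (F : Set ((Fin q → ℝ) × (Fin q × Fin q → ℝ)))
    (c : Fin q → ℕ) (k : Fin q × Fin q → ℕ) (hc : ∑ a, c a = n)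
    (hsymm : ∀ a, k a.swap = k a) (hk : ∀ i, 2 * ∑ j, k (i, j) = d * c i)
    (hF : ((fun a => (c a : ℝ) / n), (fun a => (k a : ℝ) / m)) ∈ F) :
    Real.exp (-(n * rateG μ d ((fun a => (c a : ℝ) / n), (fun a => (k a : ℝ) / m)))
      - (q + q * q : ℕ) * errL n d) ≤ configProb q n d μ F := by
  have hNpos : 0 < n * d := Nat.mul_pos hn hd
  have hm : 0 < m := by omega
  have hksum : ∑ a, k a = m := by
    rw [Fintype.sum_prod_type]
    have : 2 * ∑ i, ∑ j, k (i, j) = n * d := by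
      rw [Finset.mul_sum, Finset.sum_congr rfl fun i _ => hk i, ← Finset.mul_sum, hc, mul_comm]
    omega
  obtain ⟨η₀, hη₀⟩ := exists_word (ι := Fin n) c (by simpa using hc)
  obtain ⟨u₀, hu₀⟩ := exists_word (ι := Fin m) k (by simpa using hksum)
  have hη₀' : cnt η₀ = c := funext hη₀
  have hu₀' : cnt u₀ = k := funext hu₀
  let W : Finset (Fin (n * d) → Fin q) :=
    Finset.univ.filter fun w => pairWord hN w ∈ typeClass u₀
  have hWcard : W.card = (typeClass u₀).card := by
    refine Finset.card_bij (fun w _ => pairWord hN w) ?_ ?_ ?_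
    · intro w hw; exact (Finset.mem_filter.mp hw).2
    · intro w _ w' _ h; exact (pairWord_bij hN).1 h
    · intro u hu
      obtain ⟨w, rfl⟩ := (pairWord_bij hN).2 u
      exact ⟨w, by simpa [W] using hu, rfl⟩
  have hWb : ∀ w ∈ W, ∀ a, bondCnt (refPair hN) w a = 2 * k a := by
    intro w hw a
    have := mem_typeClass.mp (Finset.mem_filter.mp hw).2
    rw [bondCnt_refPair, this, this, hu₀', hsymm]
    ring
  have hWm : ∀ η ∈ typeClass η₀, ∀ w ∈ W, w ∈ typeClass (halfSpin (d := d) η) := by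
    intro η hη w hw
    rw [mem_typeClass] at hη ⊢
    intro a
    rw [cnt_halfSpin, hη, hη₀, ← hk, ← sum_bondCnt (refPair hN), Finset.mul_sum]
    exact Finset.sum_congr rfl fun j _ => hWb w hw _
  have hWB : ∀ w ∈ W, bondM hN w = fun a => (k a : ℝ) / m := by
    intro w hw
    funext a
    unfold bondM
    rw [hWb w hw]
    have : (n:ℝ) * d = 2 * m := by
      have : n * d = 2 * m := by omega
      exact_mod_cast this
    rw [this]
    push_cast
    rw [mul_div_mul_left _ _ (by norm_num)]
  have hterm : ∀ η ∈ typeClass η₀, ∀ w ∈ W,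
      Real.exp (∑ a, (c a : ℝ) * Real.log (μ a) + d * cent n c) ≤
      (∏ i, μ (η i)) / (typeClass (halfSpin (d := d) η)).card *
        (if (empSpin q n η, bondM hN w) ∈ F then 1 else 0) := by
    intro η hη w hw
    have hcη : cnt η = c := by
      funext a
      rw [← hη₀]
      exact mem_typeClass.mp hη a
    have hS : empSpin q n η = fun a => (c a : ℝ) / n := by rw [← hcη]; rfl
    rw [hS, hWB w hw, if_pos hF, mul_one, prod_word η μ (fun k => hμ0 _), hcη,
      le_div_iff₀ (typeClass_pos _)]
    have hup := typeClass_upper (halfSpin (d := d) η) (n * d) (by simp) hNpos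
    rw [cent_mul n d hd c _ (fun a => by rw [cnt_halfSpin, hcη])] at hup
    refine (mul_le_mul_of_nonneg_left hup (Real.exp_pos _).le).trans ?_
    rw [← Real.exp_add, Real.exp_le_exp]
    linarith
  have hnn : ∀ η : Fin n → Fin q, ∀ w, 0 ≤
      (∏ i, μ (η i)) / ((typeClass (halfSpin (d := d) η)).card : ℝ) *
        (if (empSpin q n η, bondM hN w) ∈ F then 1 else 0) := by
    intro η w
    have : 0 ≤ ∏ i, μ (η i) := Finset.prod_nonneg fun i _ => (hμ0 _).le
    split_ifs <;> positivity
  rw [configProb_eq hN]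
  have hl1 := typeClass_lower η₀ n (by simp) hn
  have hl2 := typeClass_lower u₀ m (by simp) hm
  rw [hη₀', Fintype.card_fin] at hl1
  rw [hu₀', Fintype.card_prod, Fintype.card_fin] at hl2
  have hcm : cent m k = (n:ℝ) * d / 2 * ∑ a, ((k a : ℝ) / m) * Real.log ((k a : ℝ) / m) := by
    have : (n:ℝ) * d = 2 * m := by
      have : n * d = 2 * m := by omega
      exact_mod_cast this
    unfold cent
    rw [this]; ring
  have hmono : ∀ j : ℕ, j ≤ n * d → Real.log ((j:ℝ) + 1) + 1 ≤ errL n d := by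
    intro j hj
    unfold errL
    have : (j:ℝ) ≤ ((n * d : ℕ) : ℝ) := by exact_mod_cast hj
    gcongr
  have hm1 := hmono n (Nat.le_mul_of_pos_right n hd)
  have hm2 := hmono m (by omega)
  calc _ ≤ Real.exp (-cent n c - q * (Real.log (n + 1) + 1)) *
        (Real.exp (-cent m k - (q * q : ℕ) * (Real.log (m + 1) + 1)) *
          Real.exp (∑ a, (c a : ℝ) * Real.log (μ a) + d * cent n c)) := by
        rw [← Real.exp_add, ← Real.exp_add, Real.exp_le_exp, n_rateG hn, hcm]
        have e1 : (q:ℝ) * (Real.log (n + 1) + 1) ≤ q * errL n d := by gcongr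
        have e2 : ((q * q : ℕ):ℝ) * (Real.log (m + 1) + 1) ≤ (q * q : ℕ) * errL n d := by gcongr
        push_cast at e2 ⊢
        linarith
    _ ≤ (typeClass η₀).card * ((typeClass u₀).card *
          Real.exp (∑ a, (c a : ℝ) * Real.log (μ a) + d * cent n c)) := by
        gcongr
    _ = ∑ η ∈ typeClass η₀, ∑ w ∈ W,
          Real.exp (∑ a, (c a : ℝ) * Real.log (μ a) + d * cent n c) := by
        rw [Finset.sum_const, Finset.sum_const, hWcard, nsmul_eq_mul, nsmul_eq_mul]
    _ ≤ ∑ η ∈ typeClass η₀, ∑ w ∈ typeClass (halfSpin (d := d) η),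
          (∏ i, μ (η i)) / (typeClass (halfSpin (d := d) η)).card *
        (if (empSpin q n η, bondM hN w) ∈ F then 1 else 0) := by
        refine Finset.sum_le_sum fun η hη => ?_
        refine (Finset.sum_le_sum (hterm η hη)).trans ?_
        exact Finset.sum_le_sum_of_subset_of_nonneg (hWm η hη) fun w _ _ => hnn η w
    _ ≤ _ := Finset.sum_le_sum_of_subset_of_nonneg (Finset.subset_univ _)
        fun η _ _ => Finset.sum_nonneg fun w _ => hnn η w

/-! ### Asymptotics -/

/-- The filter along which the limits are taken. -/
def evF (d : ℕ) : Filter ℕ := atTop ⊓ Filter.principal {n : ℕ | Even (n * d)}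

lemma evF_pos (d : ℕ) : ∀ᶠ n in evF d, 0 < n ∧ n * d = n * d / 2 + n * d / 2 := by
  unfold evF
  rw [Filter.eventually_inf_principal]
  filter_upwards [Filter.eventually_gt_atTop 0] with n hn he
  obtain ⟨r, hr⟩ := he
  exact ⟨hn, by omega⟩

lemma evF_cast (d : ℕ) : Tendsto (fun n : ℕ => (n : ℝ)) (evF d) atTop :=
  tendsto_natCast_atTop_atTop.mono_left inf_le_left

lemma errL_tendsto (d : ℕ) (hd : 0 < d) (K : ℝ) :
    Tendsto (fun n : ℕ => K * errL n d / n) (evF d) (nhds 0) := by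
  have h0 : Tendsto (fun x : ℝ => Real.log x / x) atTop (nhds 0) :=
    Real.isLittleO_log_id_atTop.tendsto_div_nhds_zero
  have hd' : (0:ℝ) < d := by exact_mod_cast hd
  have h1 : Tendsto (fun n : ℕ => ((n * d : ℕ) : ℝ) + 1) (evF d) atTop := by
    refine tendsto_atTop_add_const_right _ _ ?_
    push_cast
    exact (evF_cast d).atTop_mul_const hd'
  have h2 := h0.comp h1
  have h3 : Tendsto (fun n : ℕ => ((n:ℝ))⁻¹) (evF d) (nhds 0) :=
    tendsto_inv_atTop_zero.comp (evF_cast d)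
  have h4 := ((h2.mul (h3.const_add (d:ℝ))).add h3).const_mul K
  simp only [zero_mul, zero_add, mul_zero] at h4
  refine h4.congr' ?_
  filter_upwards [evF_pos d] with n hn
  have hn' : (n:ℝ) ≠ 0 := by have := hn.1; positivity
  have : ((n * d : ℕ) : ℝ) + 1 ≠ 0 := by positivity
  simp only [Function.comp, errL]
  push_cast at this ⊢
  field_simp

lemma elog_le {n : ℕ} (hn : 0 < n) {P s : ℝ} (h : P ≤ Real.exp (n * s)) :
    (((n : ℝ)⁻¹ : ℝ) : EReal) * elog (ENNReal.ofReal P) ≤ (s : EReal) := by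
  have hn' : (0:ℝ) < n := by exact_mod_cast hn
  unfold elog
  by_cases hP : P ≤ 0
  · rw [if_pos (ENNReal.ofReal_eq_zero.mpr hP), EReal.coe_mul_bot_of_pos (by positivity)]
    exact bot_le
  · push Not at hP
    rw [if_neg (by simpa using hP), if_neg ENNReal.ofReal_ne_top, ENNReal.toReal_ofReal hP.le,
      ← EReal.coe_mul, EReal.coe_le_coe_iff]
    have := (Real.log_le_iff_le_exp hP).mpr h
    rw [inv_mul_le_iff₀ hn']
    exact this

lemma le_elog {n : ℕ} (hn : 0 < n) {P s : ℝ} (h : Real.exp (n * s) ≤ P) :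
    (s : EReal) ≤ (((n : ℝ)⁻¹ : ℝ) : EReal) * elog (ENNReal.ofReal P) := by
  have hn' : (0:ℝ) < n := by exact_mod_cast hn
  unfold elog
  have hP : 0 < P := (Real.exp_pos _).trans_le h
  rw [if_neg (by simpa using hP), if_neg ENNReal.ofReal_ne_top, ENNReal.toReal_ofReal hP.le,
      ← EReal.coe_mul, EReal.coe_le_coe_iff]
  have := (Real.le_log_iff_exp_le hP).mpr h
  rw [le_inv_mul_iff₀ hn']
  exact this

lemma configProb_le_one {q : ℕ} (μ : Fin q → ℝ) (hμ0 : ∀ i, 0 < μ i) (hμ1 : ∑ i, μ i = 1)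
    (n d : ℕ) (F : Set ((Fin q → ℝ) × (Fin q × Fin q → ℝ))) : configProb q n d μ F ≤ 1 := by
  unfold configProb
  refine div_le_one_of_le₀ ?_ (by positivity)
  have h1 : ∑ η : Fin n → Fin q, ∏ i, μ (η i) = 1 := by
    rw [sum_prod_word, hμ1, one_pow]
  calc _ ≤ ∑ f ∈ pairings (n * d), (1:ℝ) := by
        refine Finset.sum_le_sum fun f _ => ?_
        refine le_trans (Finset.sum_le_sum fun η _ => ?_) h1.le
        have : 0 ≤ ∏ i, μ (η i) := Finset.prod_nonneg fun i _ => (hμ0 _).le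
        split_ifs <;> simp [this]
    _ = _ := by simp

lemma limsup_upper {q : ℕ} (μ : Fin q → ℝ) (hμ0 : ∀ i, 0 < μ i)
    (d : ℕ) (hd : 0 < d) (F : Set ((Fin q → ℝ) × (Fin q × Fin q → ℝ))) (J : ℝ)
    (hJ : ∀ x ∈ F, IsAdmissible x → J ≤ rateG μ d x) :
    Filter.limsup (fun n : ℕ =>
            (((n : ℝ)⁻¹ : ℝ) : EReal) * elog (ENNReal.ofReal (configProb q n d μ F)))
          (evF d) ≤ ((-J : ℝ) : EReal) := by
  refine le_of_forall_gt_imp_ge_of_dense fun a ha => ?_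
  have ht : Tendsto (fun n : ℕ => ((-J + (q + q + q * q : ℕ) * errL n d / n : ℝ) : EReal))
      (evF d) (nhds ((-J : ℝ) : EReal)) := by
    rw [EReal.tendsto_coe]
    simpa using (errL_tendsto d hd ((q + q + q * q : ℕ):ℝ)).const_add (-J)
  refine Filter.limsup_le_of_le (h := ?_)
  filter_upwards [ht.eventually_lt_const ha, evF_pos d] with n hn hp
  refine (elog_le hp.1 ?_).trans hn.le
  refine (upper_real hp.2 hp.1 hd μ hμ0 F J hJ).trans ?_
  rw [Real.exp_le_exp]
  have : (n:ℝ) ≠ 0 := by have := hp.1; positivity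
  apply le_of_eq
  field_simp

lemma ldp_upper {q : ℕ} (μ : Fin q → ℝ) (hμ0 : ∀ i, 0 < μ i) (hμ1 : ∑ i, μ i = 1)
    (d : ℕ) (hd : 0 < d) (F : Set ((Fin q → ℝ) × (Fin q × Fin q → ℝ))) :
    Filter.limsup (fun n : ℕ =>
            (((n : ℝ)⁻¹ : ℝ) : EReal) * elog (ENNReal.ofReal (configProb q n d μ F)))
          (evF d) ≤ -(((⨅ x ∈ closure F, rate μ d x) : ENNReal) : EReal) := by
  refine le_of_forall_gt_imp_ge_of_dense fun a ha => ?_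
  by_cases h0 : 0 ≤ a
  · refine le_trans ?_ h0
    refine Filter.limsup_le_of_le (h := ?_)
    filter_upwards [evF_pos d] with n hp
    refine elog_le (s := 0) hp.1 ?_
    simpa using configProb_le_one μ hμ0 hμ1 n d F
  · push Not at h0
    induction a with
    | bot => exact absurd ha (by simp)
    | top => exact absurd h0 (by simp)
    | coe a =>
      have ha0 : a < 0 := by exact_mod_cast h0
      have := limsup_upper μ hμ0 d hd F (-a) ?_
      · simpa using this
      · intro x hx hadm
        have h1 : ((-a : ℝ) : EReal) < (((⨅ x ∈ closure F, rate μ d x) : ENNReal) : EReal) := by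
          rw [EReal.coe_neg]
          exact EReal.neg_lt_comm.mp ha
        have h2 : (⨅ x ∈ closure F, rate μ d x) ≤ rate μ d x :=
          iInf₂_le x (subset_closure hx)
        rw [rate_eq μ hμ0 d hadm] at h2
        have h3 : ((-a : ℝ) : EReal) < ((ENNReal.ofReal (rateG μ d x) : ENNReal) : EReal) :=
          h1.trans_le (EReal.coe_ennreal_le_coe_ennreal_iff.mpr h2)
        rw [EReal.coe_ennreal_ofReal, EReal.coe_lt_coe_iff] at h3
        rcases lt_max_iff.mp h3 with h | h
        · exact h.le
        · linarith

lemma approx_exists {q : ℕ} (d : ℕ) (hd : 0 < d) (x : (Fin q → ℝ) × (Fin q × Fin q → ℝ))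
    (hx : IsAdmissible x) (hpos : ∀ a, 0 < x.2 a) :
    ∃ (c : ℕ → Fin q → ℕ) (k : ℕ → Fin q × Fin q → ℕ),
      (∀ᶠ n in evF d, ∑ a, c n a = n ∧ (∀ a, k n a.swap = k n a) ∧
        ∀ i, 2 * ∑ j, k n (i, j) = d * c n i) ∧
      Tendsto (fun n : ℕ => (((fun a => (c n a : ℝ) / n),
        (fun a => (k n a : ℝ) / ((n * d / 2 : ℕ) : ℝ))) :
          (Fin q → ℝ) × (Fin q × Fin q → ℝ))) (evF d) (nhds x) := by
  obtain ⟨ρ, ν⟩ := x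
  obtain ⟨h1, h2, h3, h4, h5⟩ := hx
  simp only at h1 h2 h3 h4 h5 hpos
  have hq : Nonempty (Fin q) := by
    by_contra h
    rw [not_nonempty_iff] at h
    simp at h2
  obtain ⟨a₀⟩ := hq
  have hd' : (0:ℝ) < d := by exact_mod_cast hd
  -- spin counts
  let b : ℕ → Fin q → ℕ := fun n a => 2 * ⌊ρ a * ((n:ℝ) / 2)⌋₊
  let c : ℕ → Fin q → ℕ := fun n a =>
    if a = a₀ then n - ∑ i ∈ Finset.univ.erase a₀, b n i else b n a
  have hb : ∀ n a, (b n a : ℝ) ≤ ρ a * n := by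
    intro n a
    have := Nat.floor_le (show 0 ≤ ρ a * ((n:ℝ) / 2) from mul_nonneg (h1 a) (by positivity))
    simp only [b]; push_cast; linarith
  have hρ0 : ρ a₀ = 1 - ∑ i ∈ Finset.univ.erase a₀, ρ i := by
    rw [← h2, ← Finset.add_sum_erase _ _ (Finset.mem_univ a₀)]; ring
  have hble : ∀ n, ∑ i ∈ Finset.univ.erase a₀, b n i ≤ n := by
    intro n
    have : (∑ i ∈ Finset.univ.erase a₀, (b n i : ℝ)) ≤ n := by
      calc _ ≤ ∑ i ∈ Finset.univ.erase a₀, ρ i * n := Finset.sum_le_sum fun i _ => hb n i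
        _ = (1 - ρ a₀) * n := by rw [← Finset.sum_mul, hρ0]; ring
        _ ≤ 1 * n := by gcongr; linarith [h1 a₀]
        _ = n := one_mul _
    exact_mod_cast this
  have hcsum : ∀ n, ∑ a, c n a = n := by
    intro n
    rw [← Finset.add_sum_erase _ _ (Finset.mem_univ a₀)]
    have : ∑ i ∈ Finset.univ.erase a₀, c n i = ∑ i ∈ Finset.univ.erase a₀, b n i :=
      Finset.sum_congr rfl fun i hi => if_neg (Finset.ne_of_mem_erase hi)
    rw [this]
    simp only [c, if_true]
    have := hble n
    omega
  have hcev : ∀ n, Even (n * d) → ∀ i, Even (d * c n i) := by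
    intro n he i
    have hbe : ∀ i, Even (b n i) := fun i => even_two_mul _
    simp only [c]
    split_ifs with hi
    · rw [Nat.mul_sub, Nat.even_sub (Nat.mul_le_mul_left d (hble n)), mul_comm d n]
      refine iff_of_true he ((Finset.even_sum _ fun i _ => hbe i).mul_left d)
    · exact (hbe i).mul_left d
  have hblim : ∀ a, Tendsto (fun n => (b n a : ℝ) / n) (evF d) (nhds (ρ a)) := by
    intro a
    have := (tendsto_nat_floor_mul_div_atTop (R := ℝ) (h1 a)).comp
      ((evF_cast d).atTop_div_const (show (0:ℝ) < 2 by norm_num))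
    refine this.congr fun n => ?_
    simp only [b, Function.comp]
    push_cast
    rw [div_div_eq_mul_div]; ring
  have hclim : ∀ a, Tendsto (fun n => (c n a : ℝ) / n) (evF d) (nhds (ρ a)) := by
    intro a
    by_cases ha : a = a₀
    · subst ha
      have h := (tendsto_finsetSum (Finset.univ.erase a) fun i _ => hblim i).const_sub 1
      rw [← hρ0] at h
      refine h.congr' ?_
      filter_upwards [evF_pos d] with n hn
      have hn' : (n:ℝ) ≠ 0 := by have := hn.1; positivity
      simp only [c, if_true]
      rw [Nat.cast_sub (hble n), ← Finset.sum_div]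
      push_cast
      field_simp
    · simpa only [c, if_neg ha] using hblim a
  -- bond counts
  let M : ℕ → ℕ := fun n => n * d / 2
  have hM2 : ∀ᶠ n : ℕ in evF d, (n:ℝ) * d = 2 * (M n : ℝ) ∧ 0 < n := by
    filter_upwards [evF_pos d] with n hn
    have : n * d = 2 * M n := by simp only [M]; omega
    exact ⟨by exact_mod_cast this, hn.1⟩
  have hMlim : Tendsto (fun n : ℕ => (M n : ℝ)) (evF d) atTop := by
    have := ((evF_cast d).atTop_mul_const hd').atTop_div_const (show (0:ℝ) < 2 by norm_num)
    refine this.congr' ?_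
    filter_upwards [hM2] with n hn
    rw [hn.1]; ring
  let g : ℕ → Fin q × Fin q → ℕ := fun n a => ⌊ν a * (M n : ℝ)⌋₊
  have hglim : ∀ a, Tendsto (fun n : ℕ => (g n a : ℝ) / M n) (evF d) (nhds (ν a)) := fun a =>
    (tendsto_nat_floor_mul_div_atTop (R := ℝ) (h3 a)).comp hMlim
  let k : ℕ → Fin q × Fin q → ℕ := fun n a =>
    if a.1 = a.2 then d * c n a.1 / 2 - ∑ j ∈ Finset.univ.erase a.1, g n (a.1, j) else g n a
  have hν0 : ∀ i, ν (i, i) = ρ i - ∑ j ∈ Finset.univ.erase i, ν (i, j) := by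
    intro i
    rw [← h5 i, ← Finset.add_sum_erase _ _ (Finset.mem_univ i)]; ring
  have hdiag : ∀ i, Tendsto (fun n : ℕ => ((d * c n i / 2 : ℕ) : ℝ) / (M n : ℝ) -
      ∑ j ∈ Finset.univ.erase i, (g n (i, j) : ℝ) / M n) (evF d) (nhds (ν (i, i))) := by
    intro i
    rw [hν0 i]
    refine Tendsto.sub ?_ (tendsto_finsetSum _ fun j _ => hglim (i, j))
    refine (hclim i).congr' ?_
    have hev : ∀ᶠ n in evF d, Even (n * d) := by
      filter_upwards [evF_pos d] with n hn
      exact ⟨_, hn.2⟩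
    filter_upwards [hM2, hev] with n hn he
    obtain ⟨r, hr⟩ := hcev n he i
    have h6 : d * c n i / 2 = r := by omega
    have h7 : (d:ℝ) * c n i = r + r := by exact_mod_cast hr
    have hn' : (0:ℝ) < n := by exact_mod_cast hn.2
    have hMp : (0:ℝ) < M n := by
      have : 0 < (n:ℝ) * d := by positivity
      linarith [hn.1]
    rw [h6, div_eq_div_iff hn'.ne' hMp.ne']
    have h8 : (r:ℝ) = d * c n i / 2 := by linarith
    have h9 : (M n : ℝ) = n * d / 2 := by linarith [hn.1]
    rw [h8, h9]; ring
  have hle : ∀ i, ∀ᶠ n in evF d, ∑ j ∈ Finset.univ.erase i, g n (i, j) ≤ d * c n i / 2 := by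
    intro i
    filter_upwards [(hdiag i).eventually_const_lt (hpos (i, i)), hM2] with n hn hn2
    rw [← Finset.sum_div, ← sub_div] at hn
    have h6 : (0:ℝ) < ((d * c n i / 2 : ℕ) : ℝ) - ∑ j ∈ Finset.univ.erase i, (g n (i, j) : ℝ) := by
      by_contra hcon
      push Not at hcon
      have := div_nonpos_of_nonpos_of_nonneg hcon (show (0:ℝ) ≤ M n by positivity)
      linarith
    have h7 : (∑ j ∈ Finset.univ.erase i, (g n (i, j) : ℝ)) ≤ ((d * c n i / 2 : ℕ) : ℝ) := by
      linarith
    exact_mod_cast h7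
  refine ⟨c, k, ?_, ?_⟩
  · filter_upwards [evF_pos d, Filter.eventually_all.mpr hle] with n hn hn2
    refine ⟨hcsum n, fun a => ?_, fun i => ?_⟩
    · obtain ⟨i, j⟩ := a
      by_cases hij : i = j
      · subst hij; rfl
      · simp only [k, Prod.swap_prod_mk, if_neg hij, if_neg (Ne.symm hij), g]
        rw [h4 j i]
    · rw [← Finset.add_sum_erase _ _ (Finset.mem_univ i)]
      have h6 : ∑ j ∈ Finset.univ.erase i, k n (i, j) = ∑ j ∈ Finset.univ.erase i, g n (i, j) :=
        Finset.sum_congr rfl fun j hj => if_neg (Ne.symm (Finset.ne_of_mem_erase hj))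
      rw [h6]
      simp only [k, if_true]
      have h7 := hn2 i
      obtain ⟨r, hr⟩ := hcev n ⟨_, hn.2⟩ i
      omega
  · refine Tendsto.prodMk_nhds (tendsto_pi_nhds.mpr hclim) (tendsto_pi_nhds.mpr ?_)
    rintro ⟨i, j⟩
    by_cases hij : i = j
    · subst hij
      refine (hdiag i).congr' ?_
      filter_upwards [hle i] with n hn
      simp only [k, if_true]
      rw [Nat.cast_sub hn, ← Finset.sum_div, ← sub_div]
      push_cast
      rfl
    · refine (hglim (i, j)).congr fun n => ?_
      simp only [k, if_neg hij]
      rfl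

lemma liminf_lower_pos {q : ℕ} (μ : Fin q → ℝ) (hμ0 : ∀ i, 0 < μ i)
    (d : ℕ) (hd : 0 < d) (F : Set ((Fin q → ℝ) × (Fin q × Fin q → ℝ)))
    (x : (Fin q → ℝ) × (Fin q × Fin q → ℝ)) (hF : x ∈ interior F)
    (hx : IsAdmissible x) (hpos : ∀ a, 0 < x.2 a) :
    ((-rateG μ d x : ℝ) : EReal) ≤ Filter.liminf (fun n : ℕ =>
            (((n : ℝ)⁻¹ : ℝ) : EReal) * elog (ENNReal.ofReal (configProb q n d μ F)))
          (evF d) := by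
  obtain ⟨c, k, hck, hlim⟩ := approx_exists d hd x hx hpos
  refine le_of_forall_lt_imp_le_of_dense fun a ha => ?_
  have hG := ((rateG_continuous μ d).tendsto x).comp hlim
  have ht := hG.neg.sub (errL_tendsto d hd ((q + q * q : ℕ):ℝ))
  rw [sub_zero] at ht
  have ht' := (EReal.tendsto_coe.mpr ht).eventually_const_lt ha
  have hFe := hlim.eventually (mem_interior_iff_mem_nhds.mp hF)
  refine Filter.le_liminf_of_le (h := ?_)
  filter_upwards [ht', evF_pos d, hck, hFe] with n hn hp hc hFn
  refine hn.le.trans (le_elog hp.1 ?_)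
  refine le_trans ?_ (lower_real hp.2 hp.1 hd μ hμ0 F (c n) (k n) hc.1 hc.2.1 hc.2.2 hFn)
  rw [Real.exp_le_exp]
  have : (n:ℝ) ≠ 0 := by have := hp.1; positivity
  apply le_of_eq
  simp only [Function.comp]
  field_simp

lemma liminf_lower {q : ℕ} (μ : Fin q → ℝ) (hμ0 : ∀ i, 0 < μ i)
    (d : ℕ) (hd : 0 < d) (F : Set ((Fin q → ℝ) × (Fin q × Fin q → ℝ)))
    (x : (Fin q → ℝ) × (Fin q × Fin q → ℝ)) (hF : x ∈ interior F)
    (hx : IsAdmissible x) :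
    ((-rateG μ d x : ℝ) : EReal) ≤ Filter.liminf (fun n : ℕ =>
            (((n : ℝ)⁻¹ : ℝ) : EReal) * elog (ENNReal.ofReal (configProb q n d μ F)))
          (evF d) := by
  have hq : Nonempty (Fin q) := by
    by_contra h
    rw [not_nonempty_iff] at h
    have := hx.2.1
    simp at this
  have hq0 : (0:ℝ) < q := by
    obtain ⟨a⟩ := hq
    exact_mod_cast a.pos
  let y : ℝ → (Fin q → ℝ) × (Fin q × Fin q → ℝ) := fun ε =>
    ((fun i => (1 - ε) * x.1 i + ε * (1 / q)), (fun a => (1 - ε) * x.2 a + ε * (1 / (q * q))))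
  have hy : Continuous y := by fun_prop
  have hy0 : y 0 = x := by simp [y]
  have hylim : Tendsto y (nhdsWithin 0 (Set.Ioi 0)) (nhds x) := by
    have := hy.tendsto 0
    rw [hy0] at this
    exact this.mono_left nhdsWithin_le_nhds
  have hG := ((rateG_continuous μ d).tendsto x).comp hylim
  refine le_of_tendsto (EReal.tendsto_coe.mpr hG.neg) ?_
  have h01 : ∀ᶠ ε in nhdsWithin (0:ℝ) (Set.Ioi 0), ε ∈ Set.Ioo (0:ℝ) 1 :=
    Ioo_mem_nhdsGT one_pos
  filter_upwards [h01, hylim.eventually (isOpen_interior.mem_nhds hF)] with ε hε hyF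
  obtain ⟨h1, h2, h3, h4, h5⟩ := hx
  have he1 : 0 < 1 - ε := by linarith [hε.2]
  have he0 := hε.1
  have hyp : ∀ a, 0 < (y ε).2 a := by
    intro a
    have := mul_nonneg he1.le (h3 a)
    simp only [y]
    positivity
  refine liminf_lower_pos μ hμ0 d hd F (y ε) hyF ⟨fun i => ?_, ?_, fun a => (hyp a).le,
    fun i j => ?_, fun i => ?_⟩ hyp
  · have := mul_nonneg he1.le (h1 i)
    simp only [y]
    positivity
  · simp only [y]
    rw [Finset.sum_add_distrib, ← Finset.mul_sum, h2]
    simp only [Finset.sum_const, Finset.card_univ, Fintype.card_fin, nsmul_eq_mul]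
    field_simp
    ring
  · simp only [y]; rw [h4]
  · simp only [y]
    rw [Finset.sum_add_distrib, ← Finset.mul_sum, h5]
    simp only [Finset.sum_const, Finset.card_univ, Fintype.card_fin, nsmul_eq_mul]
    field_simp

lemma ldp_lower {q : ℕ} (μ : Fin q → ℝ) (hμ0 : ∀ i, 0 < μ i)
    (d : ℕ) (hd : 0 < d) (F : Set ((Fin q → ℝ) × (Fin q × Fin q → ℝ))) :
    -(((⨅ x ∈ interior F, rate μ d x) : ENNReal) : EReal) ≤
    Filter.liminf (fun n : ℕ =>
            (((n : ℝ)⁻¹ : ℝ) : EReal) * elog (ENNReal.ofReal (configProb q n d μ F)))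
          (evF d) := by
  set L := Filter.liminf (fun n : ℕ =>
            (((n : ℝ)⁻¹ : ℝ) : EReal) * elog (ENNReal.ofReal (configProb q n d μ F)))
          (evF d) with hL
  rw [EReal.neg_le]
  have h1 : (-L).toENNReal ≤ ⨅ x ∈ interior F, rate μ d x := by
    refine le_iInf₂ fun x hx => ?_
    by_cases hadm : IsAdmissible x
    · have := liminf_lower μ hμ0 d hd F x hx hadm
      rw [← hL, EReal.coe_neg, EReal.neg_le] at this
      have h2 := EReal.toENNReal_le_toENNReal this
      rw [rate_eq μ hμ0 d hadm]
      simpa [EReal.toENNReal_of_ne_top] using h2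
    · simp [rate, hadm]
  exact ((le_max_right 0 (-L)).trans EReal.coe_toENNReal_eq_max.ge).trans (EReal.coe_ennreal_le_coe_ennreal_iff.mpr h1)

/-- The joint LDP for the empirical spin and bond measures of the spinned `d`-regular
configuration model: speed `n` (along `n` with `nd` even), good rate function
`I(ρ,ν) = H(ρ‖μ) + (d/2) H(ν‖ρ⊗ρ)` for admissible pairs and `∞` otherwise. -/
theorem stmt14 {q : ℕ} (μ : Fin q → ℝ) (hμ0 : ∀ i, 0 < μ i) (hμ1 : ∑ i, μ i = 1)
    (d : ℕ) (hd : 1 ≤ d) :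
    (LowerSemicontinuous (rate μ d) ∧
      ∀ t : ENNReal, t ≠ ⊤ → IsCompact {p | rate μ d p ≤ t}) ∧
    ∀ F : Set ((Fin q → ℝ) × (Fin q × Fin q → ℝ)),
      (-(((⨅ x ∈ interior F, rate μ d x) : ENNReal) : EReal) ≤
        Filter.liminf (fun n : ℕ =>
            (((n : ℝ)⁻¹ : ℝ) : EReal) * elog (ENNReal.ofReal (configProb q n d μ F)))
          (atTop ⊓ Filter.principal {n : ℕ | Even (n * d)})) ∧
      (Filter.limsup (fun n : ℕ =>
            (((n : ℝ)⁻¹ : ℝ) : EReal) * elog (ENNReal.ofReal (configProb q n d μ F)))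
          (atTop ⊓ Filter.principal {n : ℕ | Even (n * d)}) ≤
        -(((⨅ x ∈ closure F, rate μ d x) : ENNReal) : EReal)) := by
  exact ⟨rate_good μ hμ0 d, fun F => ⟨ldp_lower μ hμ0 d hd F, ldp_upper μ hμ0 hμ1 d hd F⟩⟩
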